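/- arXiv:2510.09208 — 5 statements merged into one kernel-verified Lean document; each statement's English description precedes it below -/
import Mathlib

section
/- Let K be a field and (A,·,P,R,B) a finite-dimensional symmetric averaging Rota–Baxter Frobenius commutative algebra of weight −1 over K, and let P̂ be the adjoint of P with respect to B. Define r ∈ A⊗A by r♯(a*) = R(B♮⁻¹(a*)) for all a* ∈ A*. Then R∘P̂ = P̂∘R, r is a solution of the AAYBE in the admissible averaging commutative algebra (A,·,P,P̂), r + τ(r) is invariant on (A,·), and the map (r+τ(r))♯ : A* → A is bijective. -/
open TensorProduct

noncomputable section

namespace Paper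

variable {K : Type*} [Field K]

section Defs

variable {A : Type*} [AddCommGroup A] [Module K A]
variable {V : Type*} [AddCommGroup V] [Module K V]

/-- Commutativity of a bilinear multiplication. -/
def IsComm (m : A →ₗ[K] A →ₗ[K] A) : Prop := ∀ x y, m x y = m y x

/-- Associativity of a bilinear multiplication. -/
def IsAssoc (m : A →ₗ[K] A →ₗ[K] A) : Prop := ∀ x y z, m (m x y) z = m x (m y z)

/-- `P` is an averaging operator on `(A, m)`. -/
def IsAveragingOp (m : A →ₗ[K] A →ₗ[K] A) (P : A →ₗ[K] A) : Prop :=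
  ∀ x y, m (P x) (P y) = P (m (P x) y) ∧ P (m (P x) y) = P (m x (P y))

/-- `(A, m, P, Q)` is an admissible averaging commutative algebra. -/
def IsAdmissibleAveraging (m : A →ₗ[K] A →ₗ[K] A) (P Q : A →ₗ[K] A) : Prop :=
  IsComm m ∧ IsAssoc m ∧ IsAveragingOp m P ∧
    ∀ x y, m (P x) (Q y) = Q (m (P x) y) ∧ Q (m (P x) y) = Q (m x (Q y))

/-- The flip `τ` on `A ⊗ A`. -/
def tau (r : A ⊗[K] A) : A ⊗[K] A := TensorProduct.comm K A A r

/-- The linear map `A* → A`, `a* ↦ r♯(a*)`, associated with `r ∈ A ⊗ A`,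
determined by `⟨r♯(a*), b*⟩ = ⟨r, a* ⊗ b*⟩`. -/
def sharp (r : A ⊗[K] A) : Module.Dual K A →ₗ[K] A :=
  (TensorProduct.lid K A).toLinearMap ∘ₗ LinearMap.applyₗ r ∘ₗ LinearMap.rTensorHom A

/-- `s ∈ A ⊗ A` is invariant on `(A, m)`:  `(id ⊗ L(x) - L(x) ⊗ id) s = 0` for all `x`. -/
def IsInvariant (m : A →ₗ[K] A →ₗ[K] A) (s : A ⊗[K] A) : Prop :=
  ∀ x : A, LinearMap.lTensor A (m x) s = LinearMap.rTensor A (m x) s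

/-- `(u⊗v)⊗(u'⊗v') ↦ b(u⊗u') ⊗ v ⊗ v'`. -/
def place1 (b : A ⊗[K] A →ₗ[K] A) :
    (A ⊗[K] A) ⊗[K] (A ⊗[K] A) →ₗ[K] A ⊗[K] (A ⊗[K] A) :=
  LinearMap.rTensor (A ⊗[K] A) b ∘ₗ (TensorProduct.tensorTensorTensorComm K A A A A).toLinearMap

/-- `(u⊗v)⊗(u'⊗v') ↦ u ⊗ b(v⊗u') ⊗ v'`. -/
def place2 (b : A ⊗[K] A →ₗ[K] A) :
    (A ⊗[K] A) ⊗[K] (A ⊗[K] A) →ₗ[K] A ⊗[K] (A ⊗[K] A) :=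
  LinearMap.lTensor A (LinearMap.rTensor A b) ∘ₗ
    LinearMap.lTensor A (TensorProduct.assoc K A A A).symm.toLinearMap ∘ₗ
      (TensorProduct.assoc K A A (A ⊗[K] A)).toLinearMap

/-- `(u⊗v)⊗(u'⊗v') ↦ u ⊗ u' ⊗ b(v⊗v')`. -/
def place3 (b : A ⊗[K] A →ₗ[K] A) :
    (A ⊗[K] A) ⊗[K] (A ⊗[K] A) →ₗ[K] A ⊗[K] (A ⊗[K] A) :=
  (TensorProduct.assoc K A A A).toLinearMap ∘ₗ LinearMap.lTensor (A ⊗[K] A) b ∘ₗ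
    (TensorProduct.tensorTensorTensorComm K A A A A).toLinearMap

/-- A bilinear multiplication as a linear map on the tensor square. -/
def liftM (m : A →ₗ[K] A →ₗ[K] A) : A ⊗[K] A →ₗ[K] A := TensorProduct.lift m

/-- The opposite multiplication as a linear map on the tensor square: `u ⊗ v ↦ m v u`. -/
def flipM (m : A →ₗ[K] A →ₗ[K] A) : A ⊗[K] A →ₗ[K] A :=
  TensorProduct.lift m ∘ₗ (TensorProduct.comm K A A).toLinearMap

/-- For `r = Σᵢ uᵢ ⊗ vᵢ`, the element
`𝐀(r) = Σᵢⱼ (uᵢ·uⱼ)⊗vᵢ⊗vⱼ − uᵢ⊗(uⱼ·vᵢ)⊗vⱼ + uᵢ⊗uⱼ⊗(vᵢ·vⱼ)` of `A⊗A⊗A`. -/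
def Acal (m : A →ₗ[K] A →ₗ[K] A) (r : A ⊗[K] A) : A ⊗[K] (A ⊗[K] A) :=
  place1 (liftM m) (r ⊗ₜ[K] r) - place2 (flipM m) (r ⊗ₜ[K] r) + place3 (liftM m) (r ⊗ₜ[K] r)

/-- `r` is a solution of the averaging associative Yang–Baxter equation (AAYBE) in
`(A, m, P, Q)`: `𝐀(r) = 0`, `(P⊗id − id⊗Q)(r) = 0` and `(Q⊗id − id⊗P)(r) = 0`. -/
def IsAAYBESolution (m : A →ₗ[K] A →ₗ[K] A) (P Q : A →ₗ[K] A) (r : A ⊗[K] A) : Prop :=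
  Acal m r = 0 ∧ LinearMap.rTensor A P r = LinearMap.lTensor A Q r ∧
    LinearMap.rTensor A Q r = LinearMap.lTensor A P r

/-- The co-multiplication `Δ_r : x ↦ (id ⊗ L(x) − L(x) ⊗ id)(r)`. -/
def DeltaMap (m : A →ₗ[K] A →ₗ[K] A) (r : A ⊗[K] A) : A →ₗ[K] A ⊗[K] A :=
  (LinearMap.applyₗ r ∘ₗ LinearMap.lTensorHom A) ∘ₗ m -
    (LinearMap.applyₗ r ∘ₗ LinearMap.rTensorHom A) ∘ₗ m

/-- The dual representation map `x ↦ (ρ(x))*`. -/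
def dualRep (ρ : A →ₗ[K] V →ₗ[K] V) : A →ₗ[K] Module.Dual K V →ₗ[K] Module.Dual K V :=
  Module.Dual.transpose ∘ₗ ρ

/-- `(ρ, α, β, V)` is a representation of the admissible averaging commutative algebra
`(A, m, P, Q)`. -/
def IsRep (m : A →ₗ[K] A →ₗ[K] A) (P Q : A →ₗ[K] A)
    (ρ : A →ₗ[K] V →ₗ[K] V) (α β : V →ₗ[K] V) : Prop :=
  (∀ x y v, ρ (m x y) v = ρ x (ρ y v)) ∧
  (∀ x v, ρ (P x) (α v) = α (ρ (P x) v) ∧ α (ρ (P x) v) = α (ρ x (α v))) ∧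
  (∀ x v, ρ (P x) (β v) = β (ρ (P x) v) ∧ β (ρ (P x) v) = β (ρ x (β v))) ∧
  (∀ x v, ρ (Q x) (α v) = β (ρ x (α v)) ∧ β (ρ x (α v)) = β (ρ (Q x) v))

/-- `(ρ, α, β, V, mV)` is an `(A, m, P, Q)`-representation algebra. -/
def IsRepAlg (m : A →ₗ[K] A →ₗ[K] A) (P Q : A →ₗ[K] A)
    (ρ : A →ₗ[K] V →ₗ[K] V) (α β : V →ₗ[K] V) (mV : V →ₗ[K] V →ₗ[K] V) : Prop :=
  IsRep m P Q ρ α β ∧ IsAdmissibleAveraging mV α β ∧ ∀ x u v, ρ x (mV u v) = mV (ρ x u) v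

/-- The semidirect-product multiplication on `A × V`:
`(x+u)·(y+v) = x·y + ρ(x)v + ρ(y)u + u ·_V v`. -/
def sdMul (m : A →ₗ[K] A →ₗ[K] A) (ρ : A →ₗ[K] V →ₗ[K] V) (mV : V →ₗ[K] V →ₗ[K] V) :
    (A × V) →ₗ[K] (A × V) →ₗ[K] (A × V) :=
  LinearMap.mk₂ K
    (fun p q => (m p.1 q.1, ρ p.1 q.2 + ρ q.1 p.2 + mV p.2 q.2))
    (fun p p' q => by
      simp only [Prod.fst_add, Prod.snd_add, map_add, LinearMap.add_apply, Prod.mk_add_mk,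
        Prod.mk.injEq]
      exact ⟨trivial, by abel⟩)
    (fun c p q => by
      simp only [Prod.smul_fst, Prod.smul_snd, map_smul, LinearMap.smul_apply, Prod.smul_mk,
        smul_add, Prod.mk.injEq])
    (fun p q q' => by
      simp only [Prod.fst_add, Prod.snd_add, map_add, LinearMap.add_apply, Prod.mk_add_mk,
        Prod.mk.injEq]
      exact ⟨trivial, by abel⟩)
    (fun c p q => by
      simp only [Prod.smul_fst, Prod.smul_snd, map_smul, LinearMap.smul_apply, Prod.smul_mk,
        smul_add, Prod.mk.injEq])

/-- Nondegeneracy of a bilinear form. -/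
def IsNondeg (B : A →ₗ[K] A →ₗ[K] K) : Prop := ∀ x, (∀ y, B x y = 0) → x = 0

/-- `(A, m, B)` is a symmetric Frobenius commutative algebra. -/
def IsSymFrob (m : A →ₗ[K] A →ₗ[K] A) (B : A →ₗ[K] A →ₗ[K] K) : Prop :=
  IsComm m ∧ IsAssoc m ∧ (∀ x y, B x y = B y x) ∧ IsNondeg B ∧
    ∀ x y z, B (m x y) z = B x (m y z)

/-- `R` is a Rota–Baxter operator of weight `l` on `(A, m)`. -/
def IsRB (m : A →ₗ[K] A →ₗ[K] A) (R : A →ₗ[K] A) (l : K) : Prop :=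
  ∀ x y, m (R x) (R y) = R (m (R x) y + m x (R y) + l • m x y)

/-- `(A, m, R, B)` is a symmetric Rota–Baxter Frobenius commutative algebra of weight `l`. -/
def IsSymRBFrob (m : A →ₗ[K] A →ₗ[K] A) (R : A →ₗ[K] A) (B : A →ₗ[K] A →ₗ[K] K) (l : K) :
    Prop :=
  IsSymFrob m B ∧ IsRB m R l ∧ ∀ x y, B (R x) y + B x (R y) + l • B x y = 0

/-- `(A, m, P, R, B)` is a symmetric averaging Rota–Baxter Frobenius commutative algebra of
weight `l`. -/
def IsSymAvgRBFrob (m : A →ₗ[K] A →ₗ[K] A) (P R : A →ₗ[K] A) (B : A →ₗ[K] A →ₗ[K] K)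
    (l : K) : Prop :=
  IsSymRBFrob m R B l ∧ IsAveragingOp m P ∧ P ∘ₗ R = R ∘ₗ P

/-- `(A, tr, lt)` is a special apre-perm algebra (with `x ▷ y = tr x y`, `x ◁ y = lt x y`). -/
def IsSAPP (tr lt : A →ₗ[K] A →ₗ[K] A) : Prop :=
  (∀ x y, lt x y = lt y x) ∧
  (∀ x y z, (tr + lt) x ((tr + lt) y z) = (tr + lt) ((tr + lt) x y) z ∧
      (tr + lt) ((tr + lt) x y) z = (tr + lt) ((tr + lt) y x) z) ∧
  (∀ x y z, lt ((tr + lt) x y) z = (tr + lt) x (lt y z) ∧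
      (tr + lt) x (lt y z) = - lt x (lt y z))

/-- `f(x) = id ⊗ R∘(x) + L◁(x) ⊗ id` on `A ⊗ A`. -/
def fmap (tr lt : A →ₗ[K] A →ₗ[K] A) (x : A) : A ⊗[K] A →ₗ[K] A ⊗[K] A :=
  LinearMap.lTensor A ((tr + lt).flip x) + LinearMap.rTensor A (lt x)

/-- `g(x) = L∘(x) ⊗ id − id ⊗ L∘(x)` on `A ⊗ A`. -/
def gmap (tr lt : A →ₗ[K] A →ₗ[K] A) (x : A) : A ⊗[K] A →ₗ[K] A ⊗[K] A :=
  LinearMap.rTensor A ((tr + lt) x) - LinearMap.lTensor A ((tr + lt) x)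

/-- For `r = Σᵢ uᵢ ⊗ vᵢ`, the element
`SA(r) = Σᵢⱼ (uᵢ∘uⱼ)⊗vᵢ⊗vⱼ + uᵢ⊗(vᵢ◁uⱼ)⊗vⱼ + uᵢ⊗uⱼ⊗(vⱼ∘vᵢ)` of `A⊗A⊗A`. -/
def SAcal (tr lt : A →ₗ[K] A →ₗ[K] A) (r : A ⊗[K] A) : A ⊗[K] (A ⊗[K] A) :=
  place1 (liftM (tr + lt)) (r ⊗ₜ[K] r) + place2 (liftM lt) (r ⊗ₜ[K] r) +
    place3 (flipM (tr + lt)) (r ⊗ₜ[K] r)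

/-- `(A, tr, lt, B)` is a quadratic special apre-perm algebra. -/
def IsQuadSAPP (tr lt : A →ₗ[K] A →ₗ[K] A) (B : A →ₗ[K] A →ₗ[K] K) : Prop :=
  IsSAPP tr lt ∧ (∀ x y, B x y = B y x) ∧ IsNondeg B ∧
    ∀ x y z, B (lt x y) z = - B x ((tr + lt) z y)

/-- `(A, tr, lt, R, B)` is a quadratic Rota–Baxter special apre-perm algebra of weight `l`. -/
def IsQuadRBSAPP (tr lt : A →ₗ[K] A →ₗ[K] A) (R : A →ₗ[K] A) (B : A →ₗ[K] A →ₗ[K] K)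
    (l : K) : Prop :=
  IsQuadSAPP tr lt B ∧ IsRB tr R l ∧ IsRB lt R l ∧
    ∀ x y, B (R x) y + B x (R y) + l • B x y = 0

/-- `x ◁ y = −Q(x·y)` as a bilinear map. -/
def ltOf (m : A →ₗ[K] A →ₗ[K] A) (Q : A →ₗ[K] A) : A →ₗ[K] A →ₗ[K] A :=
  - (LinearMap.llcomp K A A A Q ∘ₗ m)

/-- `x ▷ y = P(x)·y + Q(x·y)` as a bilinear map. -/
def trOf (m : A →ₗ[K] A →ₗ[K] A) (P Q : A →ₗ[K] A) : A →ₗ[K] A →ₗ[K] A :=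
  m ∘ₗ P + LinearMap.llcomp K A A A Q ∘ₗ m

/-- The multiplication `a* ◇_s b* = L*(s♯(a*))(b*)` on `A*`. -/
def diamondMap (m : A →ₗ[K] A →ₗ[K] A) (s : A ⊗[K] A) :
    Module.Dual K A →ₗ[K] Module.Dual K A →ₗ[K] Module.Dual K A :=
  dualRep m ∘ₗ sharp s

/-- The natural bilinear form `B_d(x+a*, y+b*) = ⟨a*, y⟩ + ⟨b*, x⟩` on `A × A*`. -/
def pairForm : (A × Module.Dual K A) →ₗ[K] (A × Module.Dual K A) →ₗ[K] K :=
  LinearMap.mk₂ K (fun p q => p.2 q.1 + q.2 p.1)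
    (fun p p' q => by
      simp only [Prod.fst_add, Prod.snd_add, LinearMap.add_apply, map_add]
      ring)
    (fun c p q => by
      simp only [Prod.smul_fst, Prod.smul_snd, LinearMap.smul_apply, map_smul, smul_eq_mul]
      ring)
    (fun p q q' => by
      simp only [Prod.fst_add, Prod.snd_add, LinearMap.add_apply, map_add]
      ring)
    (fun c p q => by
      simp only [Prod.smul_fst, Prod.smul_snd, LinearMap.smul_apply, map_smul, smul_eq_mul]
      ring)

/-- The Zinbiel and admissibility axioms for `(A, ⋆, P, Q)`. -/
def IsAdmAvgZinbiel (st : A →ₗ[K] A →ₗ[K] A) (P Q : A →ₗ[K] A) : Prop :=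
  (∀ x y z, st x (st y z) = st (st x y) z + st (st y x) z) ∧
  (∀ x y, st (P x) (P y) = P (st (P x) y) ∧ P (st (P x) y) = P (st x (P y))) ∧
  (∀ x y, Q (st (P x) y) = st (P x) (Q y) ∧ st (P x) (Q y) = Q (st x (Q y))) ∧
  (∀ x y, Q (st (Q x) y) = st (Q x) (P y) ∧ st (Q x) (P y) = Q (st x (P y)))

end Defs

end Paper

section Theorems

open Paper

variable {K : Type*} [Field K]
variable {A : Type*} [AddCommGroup A] [Module K A]
variable {V : Type*} [AddCommGroup V] [Module K V]

theorem aux_ext {K A W : Type*} [Field K] [AddCommGroup A] [Module K A] [AddCommGroup W]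
    [Module K W] (s : A ⊗[K] W)
    (hs : ∀ f : Module.Dual K A, TensorProduct.lid K W (LinearMap.rTensor W f s) = 0) : s = 0 := by
  classical
  let b := Module.Basis.ofVectorSpace K A
  apply (TensorProduct.equivFinsuppOfBasisLeft (N := W) b).injective
  rw [map_zero]
  ext i
  rw [TensorProduct.equivFinsuppOfBasisLeft_apply]
  simpa using hs (b.coord i)

theorem aux_ext2 {K A W : Type*} [Field K] [AddCommGroup A] [Module K A] [AddCommGroup W]
    [Module K W] (B : A →ₗ[K] A →ₗ[K] K) (hB : Function.Surjective B) (s t : A ⊗[K] W)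
    (hs : ∀ x : A, TensorProduct.lid K W (LinearMap.rTensor W (B x) s) =
      TensorProduct.lid K W (LinearMap.rTensor W (B x) t)) : s = t := by
  rw [← sub_eq_zero]
  apply aux_ext
  intro f
  obtain ⟨x, rfl⟩ := hB f
  rw [map_sub, map_sub, hs, sub_self]

theorem factorizable_from_avg_weight_neg_one [FiniteDimensional K A]
    (m : A →ₗ[K] A →ₗ[K] A) (P R : A →ₗ[K] A) (B : A →ₗ[K] A →ₗ[K] K)
    (h : IsSymAvgRBFrob m P R B (-1))
    (Phat : A →ₗ[K] A) (hPhat : ∀ x y, B (Phat x) y = B x (P y))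
    (r : A ⊗[K] A) (hr : sharp r ∘ₗ B = R) :
    R ∘ₗ Phat = Phat ∘ₗ R ∧ IsAdmissibleAveraging m P Phat ∧
      IsAAYBESolution m P Phat r ∧ IsInvariant m (r + tau r) ∧
      Function.Bijective (sharp (r + tau r)) := by
  obtain ⟨⟨⟨hc, ha, hs, hn, hf⟩, hRB, hRa⟩, hP, hPR⟩ := h
  have hPR' : ∀ x, P (R x) = R (P x) := fun x => LinearMap.congr_fun hPR x
  have hRa' : ∀ x y, B x (R y) = B x y - B (R x) y := fun x y => by
    have := hRa x y
    simp only [neg_smul, one_smul] at this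
    linear_combination this
  have eqB : ∀ x y, (∀ z, B x z = B y z) → x = y := fun x y hxy => by
    rw [← sub_eq_zero]
    exact hn _ fun z => by simp [hxy]
  have hinj : Function.Injective B := fun x y hxy => eqB x y fun z => by rw [hxy]
  have hsurj : Function.Surjective B :=
    (LinearMap.injective_iff_surjective_of_finrank_eq_finrank
      (Subspace.dual_finrank_eq (K := K) (V := A)).symm).1 hinj
  have hRP : ∀ x, R (Phat x) = Phat (R x) := fun x => eqB _ _ fun z => by
    have e1 := hRa' (Phat x) z
    have e2 := hRa' x (P z)
    rw [hPhat, hPhat, hPR'] at e1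
    rw [hPhat]
    linear_combination e1 - e2
  obtain ⟨S, hS⟩ := TensorProduct.exists_finset r
  have h1 : ∀ x, ∑ i ∈ S, B x i.1 • i.2 = R x := fun x => by
    rw [← hr, hS]
    simp [sharp, map_sum]
  have h2 : ∀ x, ∑ i ∈ S, B x i.2 • i.1 = x - R x := fun x => eqB _ _ fun z => by
    have := congrArg (B x) (h1 z)
    simp only [map_sum, map_smul, LinearMap.sum_apply, LinearMap.smul_apply, map_sub,
      LinearMap.sub_apply, smul_eq_mul] at this ⊢
    rw [← hRa', ← this]
    refine Finset.sum_congr rfl fun i _ => ?_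
    rw [hs z]; ring
  have hsh : ∀ x, sharp (r + tau r) (B x) = x := fun x => by
    have : sharp (r + tau r) (B x) = ∑ i ∈ S, B x i.1 • i.2 + ∑ i ∈ S, B x i.2 • i.1 := by
      rw [hS]
      simp [sharp, tau, map_sum]
    rw [this, h1, h2]; abel
  refine ⟨LinearMap.ext hRP, ⟨hc, ha, hP, fun x y => ⟨?_, ?_⟩⟩, ⟨?_, ?_, ?_⟩, ?_, ?_⟩
  · refine eqB _ _ fun z => ?_
    rw [hc, hf, hPhat, hPhat, hc (P x) y, hf, (hP x z).1]
  · refine eqB _ _ fun z => ?_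
    rw [hPhat, hPhat, hc (P x) y, hf, hc x, hf, hPhat, (hP x z).1, (hP x z).2]
  · have key : ∀ x y z, B x (m (y - R y) (z - R z)) - B y (m (z - R z) (R x))
        + B z (m (R x) (R y)) = 0 := by
      intro x y z
      have c1 : B y (m (z - R z) (R x)) = B (R x) (m y (z - R z)) := by
        rw [hc, hs, hf, hc y]
      have c2 : B z (m (R x) (R y)) = B (R x) (m (R y) z) := by
        rw [hs, hf]
      have c3 := hRa' x (m y (z - R z))
      have c4 := hRa' x (m (R y) z)
      have c5 := congrArg (B x) (hRB y z)
      rw [c1, c2]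
      simp only [map_add, map_sub, map_neg, LinearMap.sub_apply, neg_smul, one_smul]
        at c3 c4 c5 ⊢
      linear_combination c4 - c3 + c5
    refine aux_ext2 B hsurj _ _ fun x => aux_ext2 B hsurj _ _ fun y => eqB _ _ fun z => ?_
    rw [hs]
    have := key x y z
    rw [← h2 y, ← h2 z, ← h1 x, ← h1 y] at this
    simp only [map_zero]
    rw [LinearMap.zero_apply, ← this]
    simp only [Acal]
    simp only [map_add, map_sub]
    congr 1
    · congr 1
      · rw [hS]
        simp [place1, Paper.liftM, map_sum, TensorProduct.sum_tmul, TensorProduct.tmul_sum]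
        simp only [Finset.mul_sum]
        exact Finset.sum_congr rfl fun i _ => Finset.sum_congr rfl fun j _ => by ring
      · rw [hS]
        simp [place2, flipM, map_sum, TensorProduct.sum_tmul, TensorProduct.tmul_sum]
        simp only [Finset.mul_sum]
        rw [Finset.sum_comm]
        exact Finset.sum_congr rfl fun i _ => Finset.sum_congr rfl fun j _ => by ring
    · rw [hS]
      simp [place3, Paper.liftM, map_sum, TensorProduct.sum_tmul, TensorProduct.tmul_sum]
      simp only [Finset.mul_sum]
      exact Finset.sum_congr rfl fun i _ => Finset.sum_congr rfl fun j _ => by ring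
  · refine aux_ext2 B hsurj _ _ fun x => ?_
    have e1 := h1 (Phat x)
    have e2 := h1 x
    rw [hRP, ← e2] at e1
    rw [hS]
    simpa [map_sum, hPhat] using e1
  · refine aux_ext2 B hsurj _ _ fun x => ?_
    have e1 := h1 (P x)
    have e2 := h1 x
    have e3 : ∀ x y, B x (Phat y) = B (P x) y := fun x y => by rw [hs, hPhat, hs]
    rw [← hPR', ← e2] at e1
    rw [hS]
    simpa [map_sum, e3] using e1
  · intro a
    refine aux_ext2 B hsurj _ _ fun x => ?_
    have e1 := hsh (m x a)
    rw [hc] at e1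
    have e2 := congrArg (m a) (hsh x)
    rw [← e1, hS] at e2
    have e3 : ∀ y, B (m a x) y = B x (m a y) := fun y => by rw [hc, hf]
    rw [hS]
    simpa [sharp, tau, map_sum, e3] using e2
  · constructor
    · intro f g hfg
      obtain ⟨x, rfl⟩ := hsurj f
      obtain ⟨y, rfl⟩ := hsurj g
      rw [hsh, hsh] at hfg
      rw [hfg]
    · exact fun x => ⟨B x, hsh x⟩

end Theorems
end
end

section
/- Let K be a field and (A,·,P,Q) a finite-dimensional admissible averaging commutative algebra over K. Suppose r ∈ A⊗A is a solution of the AAYBE in (A,·,P,Q), r+τ(r) is invariant on (A,·), and (r+τ(r))♯ : A* → A is bijective (i.e. the associated averaging commutative and cocommutative infinitesimal bialgebra is factorizable). Define B(x,y) = ⟨((r+τ(r))♯)⁻¹(x), y⟩ and R = r♯∘((r+τ(r))♯)⁻¹. Then (A,·,R,B) is a symmetric Rota–Baxter Frobenius commutative algebra of weight −1, B(P(x),y) = B(x,Q(y)) for all x,y ∈ A (i.e. Q is the adjoint P̂ of P with respect to B), and P∘R = R∘P. -/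
open TensorProduct

noncomputable section

namespace PaperAux

open Paper

variable {K : Type*} [Field K] {A : Type*} [AddCommGroup A] [Module K A]

theorem sharp_tmul (u v : A) (a : Module.Dual K A) : sharp (u ⊗ₜ[K] v) a = a u • v := by
  simp [sharp]

theorem sharp_add (r s : A ⊗[K] A) (a : Module.Dual K A) :
    sharp (r + s) a = sharp r a + sharp s a := by
  simp [sharp]

theorem sharp_zero (a : Module.Dual K A) : sharp (0 : A ⊗[K] A) a = 0 := by
  simp [sharp]

theorem tau_tmul (u v : A) : tau (u ⊗ₜ[K] v) = v ⊗ₜ[K] u := by simp [tau]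

theorem tau_add (r s : A ⊗[K] A) : tau (r + s) = tau r + tau s := by simp [tau]

theorem tau_zero : tau (0 : A ⊗[K] A) = 0 := by simp [tau]

theorem sharp_tau (r : A ⊗[K] A) (a b : Module.Dual K A) :
    b (sharp r a) = a (sharp (tau r) b) := by
  induction r with
  | zero => simp [tau_zero, sharp_zero]
  | tmul u v => simp [tau_tmul, sharp_tmul, mul_comm]
  | add x y hx hy => simp [tau_add, sharp_add, hx, hy]

theorem sharp_lTensor (f : A →ₗ[K] A) (r : A ⊗[K] A) (a : Module.Dual K A) :
    sharp (LinearMap.lTensor A f r) a = f (sharp r a) := by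
  induction r with
  | zero => simp [sharp_zero]
  | tmul u v => simp [sharp_tmul]
  | add x y hx hy => simp [sharp_add, hx, hy]

theorem sharp_rTensor (f : A →ₗ[K] A) (r : A ⊗[K] A) (a : Module.Dual K A) :
    sharp (LinearMap.rTensor A f r) a = sharp r (a ∘ₗ f) := by
  induction r with
  | zero => simp [sharp_zero]
  | tmul u v => simp [sharp_tmul]
  | add x y hx hy => simp [sharp_add, hx, hy]

theorem tau_lTensor (f : A →ₗ[K] A) (r : A ⊗[K] A) :
    tau (LinearMap.lTensor A f r) = LinearMap.rTensor A f (tau r) := by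
  induction r with
  | zero => simp [tau_zero]
  | tmul u v => simp [tau_tmul]
  | add x y hx hy => simp [tau_add, hx, hy]

theorem tau_rTensor (f : A →ₗ[K] A) (r : A ⊗[K] A) :
    tau (LinearMap.rTensor A f r) = LinearMap.lTensor A f (tau r) := by
  induction r with
  | zero => simp [tau_zero]
  | tmul u v => simp [tau_tmul]
  | add x y hx hy => simp [tau_add, hx, hy]

/-- Contract the first two slots with `a` and `b`. -/
def contr (a b : Module.Dual K A) : A ⊗[K] (A ⊗[K] A) →ₗ[K] A :=
  (TensorProduct.lid K A).toLinearMap ∘ₗ LinearMap.rTensor A b ∘ₗ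
    (TensorProduct.lid K (A ⊗[K] A)).toLinearMap ∘ₗ LinearMap.rTensor (A ⊗[K] A) a

theorem contr_place1 (m : A →ₗ[K] A →ₗ[K] A) (a b : Module.Dual K A) (r s : A ⊗[K] A) :
    contr a b (place1 (liftM m) (r ⊗ₜ[K] s)) = sharp s (a ∘ₗ m (sharp (tau r) b)) := by
  induction r with
  | zero => simp [tau_zero, sharp_zero]
  | add x y hx hy =>
    simp [TensorProduct.add_tmul, tau_add, sharp_add, hx, hy, LinearMap.comp_add]
  | tmul u v =>
    induction s with
    | zero => simp [sharp_zero]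
    | add x y hx hy => simp [TensorProduct.tmul_add, sharp_add, hx, hy]
    | tmul u' v' =>
      simp [contr, place1, Paper.liftM, tau_tmul, sharp_tmul, smul_smul, mul_comm]

theorem contr_place2 (m : A →ₗ[K] A →ₗ[K] A) (hm : IsComm m) (a b : Module.Dual K A)
    (r s : A ⊗[K] A) :
    contr a b (place2 (flipM m) (r ⊗ₜ[K] s)) = sharp s (b ∘ₗ m (sharp r a)) := by
  induction r with
  | zero => simp [sharp_zero]
  | add x y hx hy =>
    simp [TensorProduct.add_tmul, sharp_add, hx, hy, LinearMap.comp_add]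
  | tmul u v =>
    induction s with
    | zero => simp [sharp_zero]
    | add x y hx hy => simp [TensorProduct.tmul_add, sharp_add, hx, hy]
    | tmul u' v' =>
      simp [contr, place2, flipM, sharp_tmul, smul_smul, hm u' v]

theorem contr_place3 (m : A →ₗ[K] A →ₗ[K] A) (a b : Module.Dual K A)
    (r s : A ⊗[K] A) :
    contr a b (place3 (liftM m) (r ⊗ₜ[K] s)) = m (sharp r a) (sharp s b) := by
  induction r with
  | zero => simp [sharp_zero]
  | add x y hx hy =>
    simp [TensorProduct.add_tmul, sharp_add, hx, hy]
  | tmul u v =>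
    induction s with
    | zero => simp [sharp_zero]
    | add x y hx hy => simp [TensorProduct.tmul_add, sharp_add, hx, hy]
    | tmul u' v' =>
      simp [contr, place3, Paper.liftM, sharp_tmul, smul_smul, mul_comm]

end PaperAux

section Theorems

open Paper

variable {K : Type*} [Field K]
variable {A : Type*} [AddCommGroup A] [Module K A]
variable {V : Type*} [AddCommGroup V] [Module K V]

theorem symAvgRBFrob_from_factorizable [FiniteDimensional K A]
    (m : A →ₗ[K] A →ₗ[K] A) (P Q : A →ₗ[K] A)
    (hadm : IsAdmissibleAveraging m P Q)
    (r : A ⊗[K] A) (hsol : IsAAYBESolution m P Q r)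
    (hinv : IsInvariant m (r + tau r))
    (hbij : Function.Bijective (sharp (r + tau r)))
    (B : A →ₗ[K] A →ₗ[K] K)
    (hB1 : ∀ x, sharp (r + tau r) (B x) = x)
    (hB2 : ∀ a : Module.Dual K A, B (sharp (r + tau r) a) = a)
    (R : A →ₗ[K] A) (hR : R ∘ₗ sharp (r + tau r) = sharp r) :
    IsSymRBFrob m R B (-1) ∧ (∀ x y, B (P x) y = B x (Q y)) ∧ P ∘ₗ R = R ∘ₗ P := by
  obtain ⟨hc, ha, -, -⟩ := hadm
  obtain ⟨hA, hPQ, hQP⟩ := hsol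
  have hRS : ∀ a, R (sharp (r + tau r) a) = sharp r a := fun a => LinearMap.congr_fun hR a
  have hS : ∀ a, sharp (r + tau r) a = sharp r a + sharp (tau r) a :=
    fun a => PaperAux.sharp_add _ _ a
  have hRx : ∀ x, R x = sharp r (B x) := fun x => by rw [← hRS, hB1]
  have hx : ∀ x, sharp r (B x) + sharp (tau r) (B x) = x := fun x => by rw [← hS, hB1]
  have htt : tau (tau r) = r := by simp [tau]
  have hBr : ∀ x a, B x (sharp r a) = a (sharp (tau r) (B x)) :=
    fun x a => PaperAux.sharp_tau r a (B x)
  have hBt : ∀ x a, B x (sharp (tau r) a) = a (sharp r (B x)) := fun x a => by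
    rw [PaperAux.sharp_tau (tau r) a (B x), htt]
  have hsymm : ∀ x y, B x y = B y x := fun x y => by
    conv_lhs => rw [← hx y]
    rw [map_add, hBr x, hBt x, ← map_add, add_comm, hx]
  have hm : ∀ x a, sharp (r + tau r) (a ∘ₗ m x) = m x (sharp (r + tau r) a) := fun x a => by
    rw [← PaperAux.sharp_rTensor, ← hinv x, PaperAux.sharp_lTensor]
  have hm2 : ∀ x y, B (m x y) = B y ∘ₗ m x := fun x y => by
    rw [← hB2 (B y ∘ₗ m x), hm, hB1]
  have hP1 : ∀ a, P (sharp r a) = sharp r (a ∘ₗ Q) := fun a => by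
    rw [← PaperAux.sharp_lTensor, ← hQP, PaperAux.sharp_rTensor]
  have hP2 : ∀ a, P (sharp (tau r) a) = sharp (tau r) (a ∘ₗ Q) := fun a => by
    rw [← PaperAux.sharp_lTensor, ← PaperAux.tau_rTensor, hPQ, PaperAux.tau_lTensor,
      PaperAux.sharp_rTensor]
  have hBP : ∀ x, B (P x) = B x ∘ₗ Q := fun x => by
    conv_lhs => rw [← hx x]
    rw [map_add, hP1, hP2, ← hS, hB2]
  refine ⟨⟨⟨hc, ha, hsymm, ?_, ?_⟩, ?_, ?_⟩, ?_, ?_⟩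
  · intro x h
    have : B x = 0 := LinearMap.ext h
    rw [← hB1 x, this, map_zero]
  · intro x y z
    rw [hc x y, hm2]; rfl
  · intro x y
    have h := congrArg (PaperAux.contr (B x) (B y)) hA
    rw [Acal, map_add, map_sub, PaperAux.contr_place1, PaperAux.contr_place2 m hc,
      PaperAux.contr_place3, map_zero, ← hm2, ← hm2, ← hRx, ← hRx, ← hRx, ← hRx] at h
    have ht : sharp (tau r) (B y) = y - R y := by
      rw [hRx, eq_sub_iff_add_eq, add_comm, hx]
    rw [ht] at h
    simp only [map_add, map_sub, LinearMap.sub_apply, neg_smul, one_smul, map_neg] at h ⊢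
    rw [hc x (R y), hc x y]
    have h2 := eq_neg_of_add_eq_zero_right h
    rw [h2]; abel
  · intro x y
    have h_sw : B x (sharp (tau r) (B y)) = B y (sharp r (B x)) := hBt x (B y)
    rw [hsymm (R x) y, hRx x, hRx y, ← h_sw, neg_smul, one_smul, ← map_add, add_comm (sharp (tau r) (B y)), hx]
    simp
  · intro x y
    rw [hBP]; rfl
  · ext x
    simp only [LinearMap.comp_apply]
    rw [hRx, hRx, hP1, hBP]

end Theorems
end
end

section
/- Let K be a field and (A,·,P,Q) an admissible averaging commutative algebra over K. Suppose r ∈ A⊗A is a solution of the AAYBE in (A,·,P,Q) and r+τ(r) is invariant on (A,·). Define x▷y = P(x)·y + Q(x·y), x◁y = −Q(x·y), and x∘y = x▷y + x◁y = P(x)·y. Then: (1) (id⊗R∘(x) + L◁(x)⊗id)(r+τ(r)) = 0 and (L∘(x)⊗id − id⊗L∘(x))(r+τ(r)) = 0 for all x ∈ A, where L∘(x)y = x∘y, R∘(x)y = y∘x, L◁(x)y = x◁y (i.e. r+τ(r) is invariant on the induced special apre-perm algebra); and (2) SA(r) = Σᵢ,ⱼ (uᵢ∘uⱼ)⊗vᵢ⊗vⱼ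 + uᵢ⊗(vᵢ◁uⱼ)⊗vⱼ + uᵢ⊗uⱼ⊗(vⱼ∘vᵢ) = 0, where r = Σᵢ uᵢ⊗vᵢ. -/
open TensorProduct

noncomputable section

section Theorems

open Paper

variable {K : Type*} [Field K]
variable {A : Type*} [AddCommGroup A] [Module K A]
variable {V : Type*} [AddCommGroup V] [Module K V]

theorem aux_circ (m : A →ₗ[K] A →ₗ[K] A) (P Q : A →ₗ[K] A) (x y : A) :
    (trOf m P Q + ltOf m Q) x y = m (P x) y := by
  simp [trOf, ltOf]

theorem aux_place1 (m : A →ₗ[K] A →ₗ[K] A) (P Q : A →ₗ[K] A) (a b : A ⊗[K] A)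
    (h : LinearMap.rTensor A P a = LinearMap.lTensor A Q a) :
    place1 (liftM (trOf m P Q + ltOf m Q)) (a ⊗ₜ[K] b) =
      LinearMap.lTensor A (LinearMap.rTensor A Q) (place1 (liftM m) (a ⊗ₜ[K] b)) := by
  have h1 : place1 (liftM (trOf m P Q + ltOf m Q)) (a ⊗ₜ[K] b) =
      place1 (liftM m) (LinearMap.rTensor A P a ⊗ₜ[K] b) := by
    clear h
    induction a with
    | zero => simp
    | add x y hx hy => simp only [TensorProduct.add_tmul, map_add, hx, hy]
    | tmul x y =>
      induction b with
      | zero => simp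
      | add x y hx hy => simp only [TensorProduct.tmul_add, map_add, hx, hy]
      | tmul z w => simp [place1, Paper.liftM, trOf, ltOf]
  rw [h1, h]
  clear h h1
  induction a with
  | zero => simp
  | add x y hx hy => simp only [TensorProduct.add_tmul, map_add, hx, hy]
  | tmul x y =>
    induction b with
    | zero => simp
    | add x y hx hy => simp only [TensorProduct.tmul_add, map_add, hx, hy]
    | tmul z w => simp [place1, Paper.liftM]

theorem aux_place2 (m : A →ₗ[K] A →ₗ[K] A) (hm : IsComm m) (Q : A →ₗ[K] A) (a b : A ⊗[K] A) :
    place2 (liftM (ltOf m Q)) (a ⊗ₜ[K] b) =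
      - LinearMap.lTensor A (LinearMap.rTensor A Q) (place2 (flipM m) (a ⊗ₜ[K] b)) := by
  induction a with
  | zero => simp
  | add x y hx hy => simp only [TensorProduct.add_tmul, map_add, hx, hy, neg_add]
  | tmul x y =>
    induction b with
    | zero => simp
    | add x y hx hy => simp only [TensorProduct.tmul_add, map_add, hx, hy, neg_add]
    | tmul z w =>
      simp [place2, Paper.liftM, flipM, ltOf, hm y z, TensorProduct.neg_tmul, TensorProduct.tmul_neg]

theorem aux_place3 (m : A →ₗ[K] A →ₗ[K] A) (hm : IsComm m) (P Q : A →ₗ[K] A) (a b : A ⊗[K] A)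
    (h : LinearMap.rTensor A Q b = LinearMap.lTensor A P b) :
    place3 (flipM (trOf m P Q + ltOf m Q)) (a ⊗ₜ[K] b) =
      LinearMap.lTensor A (LinearMap.rTensor A Q) (place3 (liftM m) (a ⊗ₜ[K] b)) := by
  have h1 : place3 (flipM (trOf m P Q + ltOf m Q)) (a ⊗ₜ[K] b) =
      place3 (liftM m) (a ⊗ₜ[K] LinearMap.lTensor A P b) := by
    clear h
    induction a with
    | zero => simp
    | add x y hx hy => simp only [TensorProduct.add_tmul, map_add, hx, hy]
    | tmul x y =>
      induction b with
      | zero => simp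
      | add x y hx hy => simp only [TensorProduct.tmul_add, map_add, hx, hy]
      | tmul z w => simp [place3, Paper.liftM, flipM, trOf, ltOf, hm y (P w)]
  rw [h1, ← h]
  clear h h1
  induction a with
  | zero => simp
  | add x y hx hy => simp only [TensorProduct.add_tmul, map_add, hx, hy]
  | tmul x y =>
    induction b with
    | zero => simp
    | add x y hx hy => simp only [TensorProduct.tmul_add, map_add, hx, hy]
    | tmul z w => simp [place3, Paper.liftM]

theorem aux_tau_r (f : A →ₗ[K] A) (a : A ⊗[K] A) :
    LinearMap.rTensor A f (tau a) = tau (LinearMap.lTensor A f a) := by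
  unfold tau
  induction a with
  | zero => simp
  | add x y hx hy => simp only [map_add, hx, hy]
  | tmul x y => simp

theorem aux_tau_l (f : A →ₗ[K] A) (a : A ⊗[K] A) :
    LinearMap.lTensor A f (tau a) = tau (LinearMap.rTensor A f a) := by
  unfold tau
  induction a with
  | zero => simp
  | add x y hx hy => simp only [map_add, hx, hy]
  | tmul x y => simp

theorem quasi_triangular_gives_sapp
    (m : A →ₗ[K] A →ₗ[K] A) (P Q : A →ₗ[K] A)
    (hadm : IsAdmissibleAveraging m P Q)
    (r : A ⊗[K] A) (hsol : IsAAYBESolution m P Q r)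
    (hinv : IsInvariant m (r + tau r)) :
    (∀ x : A, fmap (trOf m P Q) (ltOf m Q) x (r + tau r) = 0 ∧
      gmap (trOf m P Q) (ltOf m Q) x (r + tau r) = 0) ∧
    SAcal (trOf m P Q) (ltOf m Q) r = 0 := by
  obtain ⟨hc, -, -, -⟩ := hadm
  obtain ⟨hA, hPQ, hQP⟩ := hsol
  refine ⟨fun x => ⟨?_, ?_⟩, ?_⟩
  · have hs : LinearMap.rTensor A Q (r + tau r) = LinearMap.lTensor A P (r + tau r) := by
      rw [map_add, map_add, aux_tau_r, aux_tau_l, hQP, hPQ]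
    have e1 : (trOf m P Q + ltOf m Q).flip x = m x ∘ₗ P := by
      ext y
      rw [LinearMap.flip_apply, aux_circ, hc]
      rfl
    have e2 : ltOf m Q x = -(Q ∘ₗ m x) := by
      ext y
      simp [ltOf]
    rw [fmap, e1, e2, LinearMap.add_apply, LinearMap.lTensor_comp, LinearMap.rTensor_neg,
      LinearMap.rTensor_comp, LinearMap.neg_apply, LinearMap.comp_apply, LinearMap.comp_apply,
      ← hs, ← hinv x, ← LinearMap.comp_apply, ← LinearMap.comp_apply,
      LinearMap.lTensor_comp_rTensor, LinearMap.rTensor_comp_lTensor, add_neg_cancel]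
  · have e1 : (trOf m P Q + ltOf m Q) x = m (P x) := by
      ext y
      rw [aux_circ]
    rw [gmap, e1, LinearMap.sub_apply, hinv (P x), sub_self]
  · rw [SAcal, aux_place1 m P Q r r hPQ, aux_place2 m hc Q, aux_place3 m hc P Q r r hQP,
      ← sub_eq_add_neg, ← map_sub, ← map_add]
    change LinearMap.lTensor A (LinearMap.rTensor A Q) (Acal m r) = 0
    rw [hA, map_zero]

end Theorems
end
end

section
/- Let K be a field and (A,▷,◁) a finite-dimensional special apre-perm algebra over K, and let r ∈ A⊗A satisfy SA(r) = 0 and f(x)(r+τ(r)) = 0 and g(x)(r+τ(r)) = 0 for all x ∈ A. Define multiplications on A* by a*▷_r b* = (L∘* + R∘*)(r♯(a*))(b*) − R▷*((τ(r))♯(b*))(a*) and a*◁_r b* = R∘*((τ(r))♯(b*))(a*) − R∘*(r♯(a*))(b*). Then r♯ : A* → A is a homomorphism for both multiplications: r♯(a*)▷r♯(b*) = r♯(a*▷_r b*) and r♯(a*)◁r♯(b*) = r♯(a*◁_r b*) for all a*,b* ∈ A*; moreover (−τ(r))♯ is likewise a homomorphism for both multiplications. -/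
open TensorProduct

noncomputable section

section Helpers

open Paper

variable {K : Type*} [Field K]
variable {A : Type*} [AddCommGroup A] [Module K A]

theorem sharp_tmul' (u v : A) (a : Module.Dual K A) : sharp (u ⊗ₜ[K] v) a = a u • v := by
  simp [sharp]

theorem sharp_add' (r s : A ⊗[K] A) (a : Module.Dual K A) :
    sharp (r + s) a = sharp r a + sharp s a := by
  simp [sharp]

theorem sharp_neg' (r : A ⊗[K] A) (a : Module.Dual K A) :
    sharp (-r) a = -sharp r a := by
  simp [sharp]

theorem sharp_zero' (a : Module.Dual K A) : sharp (0 : A ⊗[K] A) a = 0 := by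
  simp [sharp]

theorem tau_tmul' (u v : A) : tau (u ⊗ₜ[K] v) = v ⊗ₜ[K] u := by
  simp [tau]

theorem tau_add' (r s : A ⊗[K] A) : tau (r + s) = tau r + tau s := by
  simp [tau]

theorem tau_zero' : tau (0 : A ⊗[K] A) = 0 := by
  simp [tau]

/-- `⟨r♯ a, b⟩ = ⟨(τ r)♯ b, a⟩`. -/
theorem sharp_pair (r : A ⊗[K] A) (a b : Module.Dual K A) :
    b (sharp r a) = a (sharp (tau r) b) := by
  induction r using TensorProduct.induction_on with
  | zero => simp [sharp_zero', tau_zero']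
  | tmul u v => simp [sharp_tmul', tau_tmul', mul_comm]
  | add x y hx hy => simp [sharp_add', tau_add', hx, hy]

/-- Pairing of `A ⊗ A ⊗ A` with `a ⊗ b ⊗ c`. -/
def tri (a b c : Module.Dual K A) : A ⊗[K] (A ⊗[K] A) →ₗ[K] K :=
  TensorProduct.lift ((LinearMap.lsmul K K).compl₁₂ a
    (TensorProduct.lift ((LinearMap.lsmul K K).compl₁₂ b c)))

theorem tri_tmul (a b c : Module.Dual K A) (x y z : A) :
    tri a b c (x ⊗ₜ[K] (y ⊗ₜ[K] z)) = a x * (b y * c z) := by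
  simp [tri]

theorem tri_place1 (m : A →ₗ[K] A →ₗ[K] A) (a b c : Module.Dual K A) (r s : A ⊗[K] A) :
    tri a b c (place1 (liftM m) (r ⊗ₜ[K] s)) = a (m (sharp (tau r) b) (sharp (tau s) c)) := by
  induction r using TensorProduct.induction_on with
  | zero => simp [sharp_zero', tau_zero']
  | add x y hx hy => simp [sharp_add', tau_add', TensorProduct.add_tmul, hx, hy]
  | tmul u v =>
    induction s using TensorProduct.induction_on with
    | zero => simp [sharp_zero', tau_zero']
    | add x y hx hy => simp [sharp_add', tau_add', TensorProduct.tmul_add, hx, hy]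
    | tmul p q =>
      simp [sharp_tmul', tau_tmul', place1, Paper.liftM, tri_tmul]
      ring

theorem tri_place2 (m : A →ₗ[K] A →ₗ[K] A) (a b c : Module.Dual K A) (r s : A ⊗[K] A) :
    tri a b c (place2 (liftM m) (r ⊗ₜ[K] s)) = b (m (sharp r a) (sharp (tau s) c)) := by
  induction r using TensorProduct.induction_on with
  | zero => simp [sharp_zero']
  | add x y hx hy => simp [sharp_add', TensorProduct.add_tmul, hx, hy]
  | tmul u v =>
    induction s using TensorProduct.induction_on with
    | zero => simp [sharp_zero', tau_zero']
    | add x y hx hy => simp [sharp_add', tau_add', TensorProduct.tmul_add, hx, hy]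
    | tmul p q =>
      simp [sharp_tmul', tau_tmul', place2, Paper.liftM, tri_tmul]
      ring

theorem tri_place3 (m : A →ₗ[K] A →ₗ[K] A) (a b c : Module.Dual K A) (r s : A ⊗[K] A) :
    tri a b c (place3 (flipM m) (r ⊗ₜ[K] s)) = c (m (sharp s b) (sharp r a)) := by
  induction r using TensorProduct.induction_on with
  | zero => simp [sharp_zero']
  | add x y hx hy => simp [sharp_add', TensorProduct.add_tmul, hx, hy]
  | tmul u v =>
    induction s using TensorProduct.induction_on with
    | zero => simp [sharp_zero']
    | add x y hx hy => simp [sharp_add', TensorProduct.tmul_add, hx, hy]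
    | tmul p q =>
      simp [sharp_tmul', place3, flipM, tri_tmul]

/-- Pairing of `f(x) s` with `a ⊗ b`. -/
theorem pair_fmap (tr lt : A →ₗ[K] A →ₗ[K] A) (x : A) (s : A ⊗[K] A) (a b : Module.Dual K A) :
    b (sharp (fmap tr lt x s) a) =
      b ((tr + lt) (sharp s a) x) + a (lt x (sharp (tau s) b)) := by
  induction s using TensorProduct.induction_on with
  | zero => simp [sharp_zero', tau_zero']
  | add y z hy hz =>
    rw [map_add, sharp_add', map_add, hy, hz]
    simp [sharp_add', tau_add']
    ring
  | tmul u v =>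
    simp [fmap, sharp_add', sharp_tmul', tau_tmul']
    ring

end Helpers

section Theorems

open Paper

variable {K : Type*} [Field K]
variable {A : Type*} [AddCommGroup A] [Module K A]
variable {V : Type*} [AddCommGroup V] [Module K V]

theorem sharp_is_sapp_homomorphism [FiniteDimensional K A]
    (tr lt : A →ₗ[K] A →ₗ[K] A) (hsapp : IsSAPP tr lt)
    (r : A ⊗[K] A) (hSA : SAcal tr lt r = 0)
    (hf : ∀ x : A, fmap tr lt x (r + tau r) = 0)
    (hg : ∀ x : A, gmap tr lt x (r + tau r) = 0) :
    (∀ a b : Module.Dual K A,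
      tr (sharp r a) (sharp r b) =
        sharp r (((tr + lt) (sharp r a)).dualMap b +
          ((tr + lt).flip (sharp r a)).dualMap b -
          (tr.flip (sharp (tau r) b)).dualMap a) ∧
      lt (sharp r a) (sharp r b) =
        sharp r (((tr + lt).flip (sharp (tau r) b)).dualMap a -
          ((tr + lt).flip (sharp r a)).dualMap b)) ∧
    (∀ a b : Module.Dual K A,
      tr (sharp (-(tau r)) a) (sharp (-(tau r)) b) =
        sharp (-(tau r)) (((tr + lt) (sharp r a)).dualMap b +
          ((tr + lt).flip (sharp r a)).dualMap b -
          (tr.flip (sharp (tau r) b)).dualMap a) ∧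
      lt (sharp (-(tau r)) a) (sharp (-(tau r)) b) =
        sharp (-(tau r)) (((tr + lt).flip (sharp (tau r) b)).dualMap a -
          ((tr + lt).flip (sharp r a)).dualMap b)) := by
  have comm := hsapp.1
  have key : ∀ a b c : Module.Dual K A,
      a ((tr + lt) (sharp (tau r) b) (sharp (tau r) c)) + b (lt (sharp r a) (sharp (tau r) c)) +
        c ((tr + lt) (sharp r b) (sharp r a)) = 0 := by
    intro a b c
    rw [← tri_place1 (tr + lt) a b c r r, ← tri_place2 lt a b c r r,
      ← tri_place3 (tr + lt) a b c r r, ← map_add, ← map_add]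
    have h := congrArg (tri a b c) hSA
    rwa [map_zero] at h
  have tt : tau (tau r) = r := by simp [tau]
  have H : ∀ (a b : Module.Dual K A) (x : A),
      b ((tr + lt) (sharp r a) x) + b ((tr + lt) (sharp (tau r) a) x) +
        (a (lt x (sharp r b)) + a (lt x (sharp (tau r) b))) = 0 := by
    intro a b x
    have h := pair_fmap tr lt x (r + tau r) a b
    rw [hf x, sharp_zero', map_zero, tau_add', tt] at h
    simp only [sharp_add', map_add, LinearMap.add_apply] at h ⊢
    linear_combination -h
  have P : ∀ a b : Module.Dual K A, b (sharp r a) = a (sharp (tau r) b) := sharp_pair r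
  have Q : ∀ a b : Module.Dual K A, b (sharp (tau r) a) = a (sharp r b) := fun a b => (P b a).symm
  have ext : ∀ x y : A, (∀ c : Module.Dual K A, c x = c y) → x = y := by
    intro x y h
    rw [← sub_eq_zero, ← Module.forall_dual_apply_eq_zero_iff K]
    intro c
    rw [map_sub, h c, sub_self]
  have L1 : ∀ a b c : Module.Dual K A, c (lt (sharp r a) (sharp r b)) =
      a ((tr + lt) (sharp (tau r) c) (sharp (tau r) b)) -
        b ((tr + lt) (sharp (tau r) c) (sharp r a)) := by
    intro a b c
    have h1 := key a c b
    have h2 := H c b (sharp r a)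
    linear_combination h2 - h1
  have L2 : ∀ a b c : Module.Dual K A, c (lt (sharp (tau r) a) (sharp (tau r) b)) =
      b ((tr + lt) (sharp r c) (sharp r a)) -
        a ((tr + lt) (sharp r c) (sharp (tau r) b)) := by
    intro a b c
    have h1 := key a c b
    have h2 := H c a (sharp (tau r) b)
    rw [comm _ (sharp r a), comm _ (sharp (tau r) a)] at h2
    linear_combination h2 - h1
  refine ⟨fun a b => ⟨ext _ _ fun c => ?_, ext _ _ fun c => ?_⟩,
    fun a b => ⟨ext _ _ fun c => ?_, ext _ _ fun c => ?_⟩⟩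
  · rw [P _ c]
    have h1 := key b a c
    have h2 := H a b (sharp (tau r) c)
    have h3 := L1 a b c
    rw [comm _ (sharp r b)] at h2
    simp only [LinearMap.sub_apply, LinearMap.add_apply, LinearMap.dualMap_apply,
      LinearMap.flip_apply, map_add] at h1 h2 h3 ⊢
    linear_combination h1 - h2 - h3
  · rw [P _ c]
    have h3 := L1 a b c
    simp only [LinearMap.sub_apply, LinearMap.dualMap_apply, LinearMap.flip_apply] at h3 ⊢
    exact h3
  · rw [sharp_neg', sharp_neg', sharp_neg', map_neg c, Q _ c]
    have h1 := key c a b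
    have h3 := L2 a b c
    simp only [LinearMap.sub_apply, LinearMap.add_apply, LinearMap.dualMap_apply,
      LinearMap.flip_apply, map_add, map_neg, LinearMap.neg_apply, neg_neg] at h1 h3 ⊢
    linear_combination h1 - h3
  · rw [sharp_neg', sharp_neg', sharp_neg', map_neg c, Q _ c]
    have h3 := L2 a b c
    simp only [LinearMap.sub_apply, LinearMap.add_apply, LinearMap.dualMap_apply,
      LinearMap.flip_apply, map_add, map_neg, LinearMap.neg_apply, neg_neg] at h3 ⊢
    linear_combination h3

end Theorems
end
end

section
/- Let K be a field and (A,·,P,R,B) a finite-dimensional symmetric averaging Rota–Baxter Frobenius commutative algebra of weight λ over K, with P̂ the adjoint of P with respect to B. Define x▷y = P(x)·y + P̂(x·y) and x◁y = −P̂(x·y). Then (A,▷,◁,R,B) is a quadratic Rota–Baxter special apre-perm algebra of weight λ: (A,▷,◁) is a special apre-perm algebra, B(x◁y,z) = −B(x,z∘y) for all x,y,z (where x∘y = x▷y + x◁y), R is a Rota–Baxter operator of weight λ for both ▷ and ◁, and B(R(x),y) + B(x,R(y)) + λB(x,y) = 0 for all x,y. -/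
open TensorProduct

noncomputable section

section Theorems

open Paper

variable {K : Type*} [Field K]
variable {A : Type*} [AddCommGroup A] [Module K A]
variable {V : Type*} [AddCommGroup V] [Module K V]

theorem quad_RB_sapp_from_avg_frob [FiniteDimensional K A]
    (m : A →ₗ[K] A →ₗ[K] A) (P R : A →ₗ[K] A) (B : A →ₗ[K] A →ₗ[K] K) (l : K)
    (h : IsSymAvgRBFrob m P R B l)
    (Phat : A →ₗ[K] A) (hPhat : ∀ x y, B (Phat x) y = B x (P y)) :
    IsSAPP (trOf m P Phat) (ltOf m Phat) ∧
    (∀ x y z, B (ltOf m Phat x y) z = - B x ((trOf m P Phat + ltOf m Phat) z y)) ∧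
    IsRB (trOf m P Phat) R l ∧ IsRB (ltOf m Phat) R l ∧
    (∀ x y, B (R x) y + B x (R y) + l • B x y = 0) := by
  obtain ⟨⟨⟨hc, ha, hs, hn, hi⟩, hR, hRB⟩, hP, hPR⟩ := h
  have hext : ∀ a b, (∀ z, B a z = B b z) → a = b := by
    intro a b hab
    refine sub_eq_zero.mp (hn _ fun z => ?_)
    rw [map_sub, LinearMap.sub_apply, hab z, sub_self]
  have hPR' : ∀ x, P (R x) = R (P x) := fun x => LinearMap.congr_fun hPR x
  have h1 : ∀ x y, m (P x) (Phat y) = Phat (m (P x) y) := by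
    intro x y
    apply hext
    intro z
    rw [hc (P x) (Phat y), hi, hPhat, hPhat, hc (P x) y, hi, (hP x z).1]
  have h2 : ∀ x y, Phat (m x (Phat y)) = Phat (m (P x) y) := by
    intro x y
    apply hext
    intro z
    rw [hPhat, hPhat, hc x (Phat y), hi, hPhat, hc (P x) y, hi, (hP x z).1, (hP x z).2]
  have h3 : ∀ x, Phat (R x) = R (Phat x) := by
    intro x
    apply hext
    intro z
    have e1 := hRB x (P z)
    have e2 := hRB (Phat x) z
    rw [hPhat, hPhat, hPR'] at e2
    rw [hPhat]
    exact add_right_cancel (add_right_cancel (e1.trans e2.symm))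
  have hlt : ∀ x y, ltOf m Phat x y = - Phat (m x y) := fun x y => rfl
  have htr : ∀ x y, trOf m P Phat x y = m (P x) y + Phat (m x y) := fun x y => rfl
  have ho : ∀ x y, (trOf m P Phat + ltOf m Phat) x y = m (P x) y := by
    intro x y
    rw [LinearMap.add_apply, LinearMap.add_apply, hlt, htr, add_neg_cancel_right]
  refine ⟨⟨?_, ?_, ?_⟩, ?_, ?_, ?_, hRB⟩
  · intro x y
    rw [hlt, hlt, hc]
  · intro x y z
    simp only [ho]
    refine ⟨?_, ?_⟩
    · rw [← (hP x y).1, ha]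
    · rw [(hP x y).2, hc x (P y)]
  · intro x y z
    simp only [ho]
    simp only [hlt, map_neg, neg_neg, h1, h2, and_true]
    rw [ha]
  · intro x y z
    rw [ho, hlt, map_neg, LinearMap.neg_apply, hPhat, hi, hc y (P z)]
  · intro x y
    have e1 := hR (P x) y
    have e2 := congrArg Phat (hR x y)
    rw [h3] at e2
    rw [htr, htr, htr, htr, hPR', e1, e2, ← map_add]
    congr 1
    simp only [map_add, map_smul, smul_add]
    abel
  · intro x y
    have e2 := congrArg Phat (hR x y)
    rw [h3] at e2
    rw [hlt, hlt, hlt, hlt, e2, ← map_neg]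
    congr 1
    simp only [map_add, map_smul, smul_neg, neg_add]

end Theorems
end
end
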